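/- Let e₁, e₂, e₃ be pairwise distinct Weierstrass parameters with associated g₂, g₃, let p be a ℘-like function on a real open interval I with p(x) ∉ {e₁, e₂, e₃} for all x ∈ I, and let q₁, q₂, q₃ be the half-period translates of p. Let E ∈ ℂ. With f := E + p + q₁ + q₂ + q₃ and v := 2(p + q₁ + q₂ + q₃), at every point of I one has f²(E − v) + (1/2)·f·f'' − (1/4)·(f')² = (E + 4e₁)(E + 4e₂)(E + 4e₃). In particular Q(E) = (E + 4e₁)(E + 4e₂)(E + 4e₃) for the case (l₀, l₁, l₂, l₃) = (1,1,1,1). -/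

import Mathlib

/-- The derivative of a half-period translate `e + c / (p - e)`. -/
lemma hasDerivAt_translate {p : ℝ → ℂ} {p₁ : ℂ} {x : ℝ} (e c : ℂ) (hp : HasDerivAt p p₁ x)
    (he : p x ≠ e) :
    HasDerivAt (fun y => e + c / (p y - e)) (-(c / (p x - e) ^ 2) * p₁) x := by
  have h := ((hasDerivAt_const x c).div (hp.sub_const e) (sub_ne_zero.mpr he)).const_add e
  refine h.congr_deriv ?_
  ring

/-- The derivative of `-c / (p - e) ^ 2`. -/
lemma hasDerivAt_neg_div_sq {p : ℝ → ℂ} {p₁ : ℂ} {x : ℝ} (e c : ℂ) (hp : HasDerivAt p p₁ x)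
    (he : p x ≠ e) :
    HasDerivAt (fun y => -(c / (p y - e) ^ 2)) (2 * c / (p x - e) ^ 3 * p₁) x := by
  have he' := sub_ne_zero.mpr he
  have h := ((hasDerivAt_const x c).div ((hp.sub_const e).pow 2) (pow_ne_zero 2 he')).neg
  refine h.congr_deriv ?_
  simp only [Pi.pow_apply]
  push_cast
  field_simp
  ring

/-- The duplication formula: `P + q₁ + q₂ + q₃ = 4 ℘(2z)` satisfies the first-order Weierstrass
equation, with `d` the value of `℘'` at `z`. -/
lemma translate_sum_deriv_sq {e₁ e₂ e₃ P d : ℂ} (hsum : e₁ + e₂ + e₃ = 0)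
    (h₁ : P - e₁ ≠ 0) (h₂ : P - e₂ ≠ 0) (h₃ : P - e₃ ≠ 0)
    (hd : d ^ 2 = 4 * (P - e₁) * (P - e₂) * (P - e₃)) :
    ((1 - (e₁ - e₂) * (e₁ - e₃) / (P - e₁) ^ 2 - (e₂ - e₁) * (e₂ - e₃) / (P - e₂) ^ 2
        - (e₃ - e₁) * (e₃ - e₂) / (P - e₃) ^ 2) * d) ^ 2
      = 4 * (P + (e₁ - e₂) * (e₁ - e₃) / (P - e₁) + (e₂ - e₁) * (e₂ - e₃) / (P - e₂)
          + (e₃ - e₁) * (e₃ - e₂) / (P - e₃) - 4 * e₁)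
        * (P + (e₁ - e₂) * (e₁ - e₃) / (P - e₁) + (e₂ - e₁) * (e₂ - e₃) / (P - e₂)
          + (e₃ - e₁) * (e₃ - e₂) / (P - e₃) - 4 * e₂)
        * (P + (e₁ - e₂) * (e₁ - e₃) / (P - e₁) + (e₂ - e₁) * (e₂ - e₃) / (P - e₂)
          + (e₃ - e₁) * (e₃ - e₂) / (P - e₃) - 4 * e₃) := by
  obtain rfl : e₃ = -e₁ - e₂ := by linear_combination hsum
  rw [mul_pow, hd]
  field_simp
  ring

/-- The duplication formula: `P + q₁ + q₂ + q₃ = 4 ℘(2z)` satisfies the second-order Weierstrass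
equation, with `d` and `d'` the values of `℘'` and `℘''` at `z`. -/
lemma translate_sum_deriv_two {e₁ e₂ e₃ P d d' : ℂ} (hsum : e₁ + e₂ + e₃ = 0)
    (h₁ : P - e₁ ≠ 0) (h₂ : P - e₂ ≠ 0) (h₃ : P - e₃ ≠ 0)
    (hd : d ^ 2 = 4 * (P - e₁) * (P - e₂) * (P - e₃))
    (hd' : d' = 6 * P ^ 2 + 2 * (e₁ * e₂ + e₂ * e₃ + e₃ * e₁)) :
    (2 * ((e₁ - e₂) * (e₁ - e₃)) / (P - e₁) ^ 3 + 2 * ((e₂ - e₁) * (e₂ - e₃)) / (P - e₂) ^ 3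
        + 2 * ((e₃ - e₁) * (e₃ - e₂)) / (P - e₃) ^ 3) * d ^ 2
      + (1 - (e₁ - e₂) * (e₁ - e₃) / (P - e₁) ^ 2 - (e₂ - e₁) * (e₂ - e₃) / (P - e₂) ^ 2
        - (e₃ - e₁) * (e₃ - e₂) / (P - e₃) ^ 2) * d'
      = 6 * (P + (e₁ - e₂) * (e₁ - e₃) / (P - e₁) + (e₂ - e₁) * (e₂ - e₃) / (P - e₂)
          + (e₃ - e₁) * (e₃ - e₂) / (P - e₃)) ^ 2
        + 32 * (e₁ * e₂ + e₂ * e₃ + e₃ * e₁) := by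
  obtain rfl : e₃ = -e₁ - e₂ := by linear_combination hsum
  rw [hd, hd']
  field_simp
  ring


/-- Case `(l₀,l₁,l₂,l₃) = (1,1,1,1)`: with `f = E + p + q₁ + q₂ + q₃` and
`v = 2(p + q₁ + q₂ + q₃)`, the quantity `f² (E - v) + (1/2) f f'' - (1/4) (f')²` equals
`(E + 4e₁)(E + 4e₂)(E + 4e₃)` pointwise; in particular this is `Q(E)`. -/
theorem case_1111_Q_polynomial
    (a b : ℝ) (e₁ e₂ e₃ g₂ g₃ : ℂ)
    (hsum : e₁ + e₂ + e₃ = 0)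
    (hne₁₂ : e₁ ≠ e₂) (hne₂₃ : e₂ ≠ e₃) (hne₁₃ : e₁ ≠ e₃)
    (hg₂ : g₂ = -4 * (e₁ * e₂ + e₂ * e₃ + e₃ * e₁))
    (hg₃ : g₃ = 4 * e₁ * e₂ * e₃)
    (p p' p'' p''' : ℝ → ℂ)
    (hp : ∀ x ∈ Set.Ioo a b, HasDerivAt p (p' x) x)
    (hp' : ∀ x ∈ Set.Ioo a b, HasDerivAt p' (p'' x) x)
    (hp'' : ∀ x ∈ Set.Ioo a b, HasDerivAt p'' (p''' x) x)
    (hpde : ∀ x ∈ Set.Ioo a b, (p' x) ^ 2 = 4 * (p x) ^ 3 - g₂ * p x - g₃)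
    (hpde' : ∀ x ∈ Set.Ioo a b, p'' x = 6 * (p x) ^ 2 - (1/2) * g₂)
    (havoid : ∀ x ∈ Set.Ioo a b, p x ≠ e₁ ∧ p x ≠ e₂ ∧ p x ≠ e₃)
    (E : ℂ) :
    let q₁ : ℝ → ℂ := fun x => e₁ + (e₁ - e₂) * (e₁ - e₃) / (p x - e₁)
    let q₂ : ℝ → ℂ := fun x => e₂ + (e₂ - e₁) * (e₂ - e₃) / (p x - e₂)
    let q₃ : ℝ → ℂ := fun x => e₃ + (e₃ - e₁) * (e₃ - e₂) / (p x - e₃)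
    let f : ℝ → ℂ := fun x => E + p x + q₁ x + q₂ x + q₃ x
    let v : ℝ → ℂ := fun x => 2 * (p x + q₁ x + q₂ x + q₃ x)
    ∀ f₁ f₂ : ℝ → ℂ,
      (∀ x ∈ Set.Ioo a b, HasDerivAt f (f₁ x) x) →
      (∀ x ∈ Set.Ioo a b, HasDerivAt f₁ (f₂ x) x) →
      ∀ x ∈ Set.Ioo a b,
        (f x) ^ 2 * (E - v x) + (1/2) * f x * f₂ x - (1/4) * (f₁ x) ^ 2
          = (E + 4 * e₁) * (E + 4 * e₂) * (E + 4 * e₃) := by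
  intro q₁ q₂ q₃ f v f₁ f₂ hf hf₁ x hx
  set R₁ : ℝ → ℂ := fun y => 1 + -((e₁ - e₂) * (e₁ - e₃) / (p y - e₁) ^ 2)
    + -((e₂ - e₁) * (e₂ - e₃) / (p y - e₂) ^ 2)
    + -((e₃ - e₁) * (e₃ - e₂) / (p y - e₃) ^ 2) with hR₁
  have hf₁_eq : ∀ y ∈ Set.Ioo a b, f₁ y = R₁ y * p' y := fun y hy => by
    obtain ⟨hy₁, hy₂, hy₃⟩ := havoid y hy
    have h := ((((hp y hy).const_add E).add
      (hasDerivAt_translate e₁ ((e₁ - e₂) * (e₁ - e₃)) (hp y hy) hy₁)).add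
      (hasDerivAt_translate e₂ ((e₂ - e₁) * (e₂ - e₃)) (hp y hy) hy₂)).add
      (hasDerivAt_translate e₃ ((e₃ - e₁) * (e₃ - e₂)) (hp y hy) hy₃)
    rw [(hf y hy).unique h]
    ring
  obtain ⟨hx₁, hx₂, hx₃⟩ := havoid x hx
  have hR₁' := (((hasDerivAt_neg_div_sq e₁ ((e₁ - e₂) * (e₁ - e₃)) (hp x hx) hx₁).const_add 1).add
    (hasDerivAt_neg_div_sq e₂ ((e₂ - e₁) * (e₂ - e₃)) (hp x hx) hx₂)).add
    (hasDerivAt_neg_div_sq e₃ ((e₃ - e₁) * (e₃ - e₂)) (hp x hx) hx₃)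
  have hf₂_eq := (hf₁ x hx).unique ((hR₁'.mul (hp' x hx)).congr_of_eventuallyEq
    (Filter.eventually_of_mem (Ioo_mem_nhds hx.1 hx.2) hf₁_eq))
  have hd : p' x ^ 2 = 4 * (p x - e₁) * (p x - e₂) * (p x - e₃) := by
    rw [hpde x hx, hg₂, hg₃]
    linear_combination 4 * p x ^ 2 * hsum
  have hd' : p'' x = 6 * p x ^ 2 + 2 * (e₁ * e₂ + e₂ * e₃ + e₃ * e₁) := by
    rw [hpde' x hx, hg₂]
    ring
  have hx₁' := sub_ne_zero.mpr hx₁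
  have hx₂' := sub_ne_zero.mpr hx₂
  have hx₃' := sub_ne_zero.mpr hx₃
  have hfst := translate_sum_deriv_sq hsum hx₁' hx₂' hx₃' hd
  have hsnd := translate_sum_deriv_two hsum hx₁' hx₂' hx₃' hd hd'
  set s := p x + (e₁ - e₂) * (e₁ - e₃) / (p x - e₁) + (e₂ - e₁) * (e₂ - e₃) / (p x - e₂)
    + (e₃ - e₁) * (e₃ - e₂) / (p x - e₃) with hs
  have hfx : f x = E + s := by
    simp only [f, q₁, q₂, q₃, hs]
    linear_combination hsum
  have hvx : v x = 2 * s := by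
    simp only [v, q₁, q₂, q₃, hs]
    linear_combination 2 * hsum
  have hf₁_sq : f₁ x ^ 2 = 4 * (s - 4 * e₁) * (s - 4 * e₂) * (s - 4 * e₃) := by
    rw [← hfst, hf₁_eq x hx, hR₁]
    ring
  have hf₂x : f₂ x = 6 * s ^ 2 + 32 * (e₁ * e₂ + e₂ * e₃ + e₃ * e₁) := by
    rw [← hsnd, hf₂_eq]
    simp only [Pi.add_apply]
    ring
  rw [hfx, hvx, hf₁_sq, hf₂x]
  obtain rfl : e₃ = -e₁ - e₂ := by linear_combination hsum
  ring
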